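/- Let (ψ, (P_x^a), (Q_y^b)) be any finite-dimensional strategy inducing the ideal correlation p*. Then the multiset of nonzero Schmidt coefficients of ψ splits as Schmidt(ψ) = Schmidt((P_0^0⊗I)ψ) + Schmidt((P_0^1⊗I)ψ) (multiset sum). -/

import Mathlib

open Matrix Kronecker

noncomputable section

namespace Sep

/-- Pauli `σz`. -/
def sz : Matrix (Fin 2) (Fin 2) ℝ := !![1, 0; 0, -1]

/-- Pauli `σx`. -/
def sx : Matrix (Fin 2) (Fin 2) ℝ := !![0, 1; 1, 0]

/-- `μ = arctan (sin 2θ)` where `θ = arctan α`. -/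
def mu (α : ℝ) : ℝ := Real.arctan (Real.sin (2 * Real.arctan α))

/-- The tilted Pauli `σαz`. -/
def saz (α : ℝ) : Matrix (Fin 2) (Fin 2) ℝ :=
  Real.cos (mu α) • sz + Real.sin (mu α) • sx

/-- The tilted Pauli `σαx`. -/
def sax (α : ℝ) : Matrix (Fin 2) (Fin 2) ℝ :=
  Real.cos (mu α) • sz - Real.sin (mu α) • sx

/-- Orthogonal projection onto the `+1`-eigenspace of a symmetric involution `O`
(with eigenvalues `+1` and `-1`): `O⁺ = (I + O)/2`. -/
def pl (O : Matrix (Fin 2) (Fin 2) ℝ) : Matrix (Fin 2) (Fin 2) ℝ := (2 : ℝ)⁻¹ • (1 + O)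

/-- Orthogonal projection onto the `-1`-eigenspace: `O⁻ = (I - O)/2`. -/
def mn (O : Matrix (Fin 2) (Fin 2) ℝ) : Matrix (Fin 2) (Fin 2) ℝ := (2 : ℝ)⁻¹ • (1 - O)

/-- Embed a `2×2` matrix `O` as an `ℕ×ℕ` matrix supported on rows/columns `f 0, f 1`,
with entry `O r s` at position `(f r, f s)`. -/
def embed (f : Fin 2 → ℕ) (O : Matrix (Fin 2) (Fin 2) ℝ) : Matrix ℕ ℕ ℝ :=
  fun i j => ∑ r : Fin 2, ∑ s : Fin 2, if i = f r ∧ j = f s then O r s else 0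

/-- `ev_m(O)`: supported on `{2m, 2m+1}`. -/
def evm (m : ℕ) (O : Matrix (Fin 2) (Fin 2) ℝ) : Matrix ℕ ℕ ℝ :=
  embed (fun r => 2 * m + (r : ℕ)) O

/-- `od_m(O)`: supported on `{2m+1, 2m+2}`. -/
def odm (m : ℕ) (O : Matrix (Fin 2) (Fin 2) ℝ) : Matrix ℕ ℕ ℝ :=
  embed (fun r => 2 * m + 1 + (r : ℕ)) O

/-- Entrywise sum `Σ_m F m` of a family of `ℕ×ℕ` matrices. -/
def sumB (F : ℕ → Matrix ℕ ℕ ℝ) : Matrix ℕ ℕ ℝ := fun i j => ∑' m, F m i j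

/-- The `ℕ×ℕ` matrix with a single `1` entry at `(0,0)`. -/
def E00 : Matrix ℕ ℕ ℝ := fun i j => if i = 0 ∧ j = 0 then 1 else 0

/-- Alice's ideal operators `A_x^a`. -/
def Aop : Fin 4 → Fin 3 → Matrix ℕ ℕ ℝ :=
  ![![sumB (fun m => evm m (pl sz)), sumB (fun m => evm m (mn sz)), 0],
    ![sumB (fun m => evm m (pl sx)), sumB (fun m => evm m (mn sx)), 0],
    ![sumB (fun m => odm m (mn sz)), sumB (fun m => odm m (pl sz)), E00],
    ![sumB (fun m => odm m (mn sx)), sumB (fun m => odm m (pl sx)), E00]]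

/-- Bob's ideal operators `B_y^b`. -/
def Bop (α : ℝ) : Fin 5 → Fin 3 → Matrix ℕ ℕ ℝ :=
  ![![sumB (fun m => evm m (pl (saz α))), sumB (fun m => evm m (mn (saz α))), 0],
    ![sumB (fun m => evm m (pl (sax α))), sumB (fun m => evm m (mn (sax α))), 0],
    ![sumB (fun m => odm m (mn (saz α))), sumB (fun m => odm m (pl (saz α))), E00],
    ![sumB (fun m => odm m (mn (sax α))), sumB (fun m => odm m (pl (sax α))), E00],
    ![Aop 0 0, Aop 0 1, Aop 0 2]]

/-- The ideal correlation `p*(a,b|x,y) = (1-α²) Σ_{i,k} α^{i+k} A_x^a(i,k) B_y^b(i,k)`. -/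
def pstar (α : ℝ) (x : Fin 4) (y : Fin 5) (a b : Fin 3) : ℝ :=
  (1 - α ^ 2) * ∑' ik : ℕ × ℕ, α ^ (ik.1 + ik.2) * Aop x a ik.1 ik.2 * Bop α y b ik.1 ik.2

/-- A finite-dimensional strategy on question sets `Fin 4`, `Fin 5` and
answer sets `Fin 3`, `Fin 3`. -/
structure Strategy (dA dB : ℕ) where
  ψ : Fin dA × Fin dB → ℂ
  P : Fin 4 → Fin 3 → Matrix (Fin dA) (Fin dA) ℂ
  Q : Fin 5 → Fin 3 → Matrix (Fin dB) (Fin dB) ℂ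
  unit : ∑ p : Fin dA × Fin dB, Complex.normSq (ψ p) = 1
  P_sa : ∀ x a, (P x a)ᴴ = P x a
  P_proj : ∀ x a, P x a * P x a = P x a
  P_complete : ∀ x, ∑ a, P x a = 1
  Q_sa : ∀ y b, (Q y b)ᴴ = Q y b
  Q_proj : ∀ y b, Q y b * Q y b = Q y b
  Q_complete : ∀ y, ∑ b, Q y b = 1

/-- Action of `P ⊗ I` on a bipartite vector. -/
def actA {dA dB : ℕ} (P : Matrix (Fin dA) (Fin dA) ℂ) (ψ : Fin dA × Fin dB → ℂ) :
    Fin dA × Fin dB → ℂ := fun p => ∑ k, P p.1 k * ψ (k, p.2)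

/-- Action of `I ⊗ Q` on a bipartite vector. -/
def actB {dA dB : ℕ} (Q : Matrix (Fin dB) (Fin dB) ℂ) (ψ : Fin dA × Fin dB → ℂ) :
    Fin dA × Fin dB → ℂ := fun p => ∑ l, Q p.2 l * ψ (p.1, l)

/-- The correlation induced by a strategy: `⟨ψ, (P_x^a ⊗ Q_y^b) ψ⟩`. -/
def induced {dA dB : ℕ} (S : Strategy dA dB) (x : Fin 4) (y : Fin 5) (a b : Fin 3) : ℂ :=
  ∑ p : Fin dA × Fin dB, (starRingEnd ℂ) (S.ψ p) * actA (S.P x a) (actB (S.Q y b) S.ψ) p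

end Sep

namespace Sep

/-- The coefficient matrix of a bipartite vector. -/
def cmat {dA dB : ℕ} (φ : Fin dA × Fin dB → ℂ) : Matrix (Fin dA) (Fin dB) ℂ :=
  Matrix.of fun i j => φ (i, j)

/-- The multiset of nonzero Schmidt coefficients of a bipartite vector `φ`:
the square roots of the nonzero eigenvalues (with multiplicity) of `M·Mᴴ`,
where `M` is the coefficient matrix of `φ`. -/
def schmidt {dA dB : ℕ} (φ : Fin dA × Fin dB → ℂ) : Multiset ℝ :=
  Multiset.map Real.sqrt
    ((Multiset.map
        (Matrix.isHermitian_mul_conjTranspose_self (cmat φ)).eigenvalues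
        Finset.univ.val).filter (fun t => t ≠ 0))

end Sep

namespace Sep

open scoped ComplexOrder

/-- Matrices with `X * Y = 0` satisfy `charpoly X * charpoly Y = T ^ n * charpoly (X + Y)`. -/
lemma charpoly_mul_charpoly_of_mul_eq_zero {n R : Type*} [Fintype n] [DecidableEq n]
    [CommRing R] {X Y : Matrix n n R} (h : X * Y = 0) :
    X.charpoly * Y.charpoly = Polynomial.X ^ Fintype.card n * (X + Y).charpoly := by
  have key : X.charmatrix * Y.charmatrix = (Polynomial.X : Polynomial R) • (X + Y).charmatrix := by
    have hXY : Polynomial.C.mapMatrix X * Polynomial.C.mapMatrix Y = 0 := by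
      rw [← map_mul, h, map_zero]
    have hscalar : scalar n (Polynomial.X : Polynomial R) = (Polynomial.X : Polynomial R) • 1 := by
      rw [scalar_apply, smul_one_eq_diagonal]
    simp only [charmatrix, hscalar, map_add, sub_mul, mul_sub, hXY, Matrix.smul_mul,
      Matrix.mul_smul, Matrix.one_mul, Matrix.mul_one, smul_sub, smul_add, sub_zero]
    abel
  rw [charpoly, charpoly, charpoly, ← det_mul, key, det_smul]

/-- For Hermitian matrices with `X * Y = 0`, the nonzero eigenvalues of `X + Y` are those of `X`
together with those of `Y`. -/
lemma filter_eigenvalues_of_mul_eq_zero {n 𝕜 : Type*} [Fintype n] [DecidableEq n] [RCLike 𝕜]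
    {X Y Z : Matrix n n 𝕜} (hX : X.IsHermitian) (hY : Y.IsHermitian) (hZ : Z.IsHermitian)
    (hadd : Z = X + Y) (h : X * Y = 0) :
    (Finset.univ.val.map hZ.eigenvalues).filter (fun t => t ≠ 0) =
      (Finset.univ.val.map hX.eigenvalues).filter (fun t => t ≠ 0) +
        (Finset.univ.val.map hY.eigenvalues).filter (fun t => t ≠ 0) := by
  have hroots := congrArg Polynomial.roots (charpoly_mul_charpoly_of_mul_eq_zero h)
  rw [← hadd, Polynomial.roots_mul ((charpoly_monic X).mul (charpoly_monic Y)).ne_zero,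
    Polynomial.roots_mul ((Polynomial.monic_X_pow _).mul (charpoly_monic Z)).ne_zero,
    Polynomial.roots_X_pow, hX.roots_charpoly_eq_eigenvalues, hY.roots_charpoly_eq_eigenvalues,
    hZ.roots_charpoly_eq_eigenvalues] at hroots
  have hreal : Finset.univ.val.map hX.eigenvalues + Finset.univ.val.map hY.eigenvalues =
      Multiset.replicate (Fintype.card n) 0 + Finset.univ.val.map hZ.eigenvalues := by
    apply Multiset.map_injective (RCLike.ofReal_injective (K := 𝕜))
    simpa [Multiset.nsmul_singleton] using hroots
  rw [← Multiset.filter_add, hreal, Multiset.filter_add,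
    Multiset.filter_eq_nil.2 fun t ht => not_not.2 (Multiset.eq_of_mem_replicate ht), zero_add]

/-- Orthogonal projections summing to the identity are pairwise orthogonal. -/
lemma proj_mul_proj_eq_zero {n ι 𝕜 : Type*} [Fintype n] [DecidableEq n] [Fintype ι] [RCLike 𝕜]
    {P : ι → Matrix n n 𝕜} (hsa : ∀ a, (P a)ᴴ = P a) (hproj : ∀ a, P a * P a = P a)
    (hsum : ∑ a, P a = 1) {a b : ι} (hab : a ≠ b) : P a * P b = 0 := by
  classical
  have hsq : ∀ c, (P c * P b)ᴴ * (P c * P b) = P b * P c * P b := fun c => by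
    rw [conjTranspose_mul, hsa, hsa, Matrix.mul_assoc, ← Matrix.mul_assoc (P c), hproj,
      Matrix.mul_assoc]
  have htotal : ∑ c, P b * P c * P b = P b := by
    rw [← Finset.sum_mul, ← Finset.mul_sum, hsum, Matrix.mul_one, hproj]
  rw [← Finset.add_sum_erase _ _ (Finset.mem_univ b), hproj, hproj, add_eq_left] at htotal
  have htrace := congrArg trace htotal
  rw [trace_sum, trace_zero, Finset.sum_eq_zero_iff_of_nonneg] at htrace
  · rw [← trace_conjTranspose_mul_self_eq_zero_iff, hsq]
    exact htrace a (Finset.mem_erase.2 ⟨hab, Finset.mem_univ a⟩)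
  · exact fun c _ => hsq c ▸ (posSemidef_conjTranspose_mul_self _).trace_nonneg

lemma cmat_actA {dA dB : ℕ} (P : Matrix (Fin dA) (Fin dA) ℂ) (φ : Fin dA × Fin dB → ℂ) :
    cmat (actA P φ) = P * cmat φ := rfl

lemma cmat_actB {dA dB : ℕ} (Q : Matrix (Fin dB) (Fin dB) ℂ) (φ : Fin dA × Fin dB → ℂ) :
    cmat (actB Q φ) = cmat φ * Qᵀ := by
  ext i j
  simp [cmat, actB, mul_apply, mul_comm]

lemma sum_conj_mul_eq_trace {dA dB : ℕ} (φ χ : Fin dA × Fin dB → ℂ) :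
    ∑ p, (starRingEnd ℂ) (φ p) * χ p = trace ((cmat φ)ᴴ * cmat χ) := by
  simp only [trace, diag_apply, mul_apply, conjTranspose_apply, cmat, of_apply,
    Fintype.sum_prod_type]
  exact Finset.sum_comm

/-- An outcome pair of probability zero is annihilated by the corresponding projections. -/
lemma mul_cmat_mul_eq_zero_of_induced_eq_zero {dA dB : ℕ} (S : Strategy dA dB) {x : Fin 4}
    {y : Fin 5} {a b : Fin 3} (h : induced S x y a b = 0) :
    S.P x a * cmat S.ψ * (S.Q y b)ᵀ = 0 := by
  have hQ : ((S.Q y b)ᵀ)ᴴ = (S.Q y b)ᵀ :=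
    IsHermitian.transpose (S.Q_sa y b)
  have hQQ : (S.Q y b)ᵀ * (S.Q y b)ᵀ = (S.Q y b)ᵀ := by
    rw [← transpose_mul, S.Q_proj]
  rw [induced, sum_conj_mul_eq_trace, cmat_actA, cmat_actB] at h
  rw [← trace_conjTranspose_mul_self_eq_zero_iff, conjTranspose_mul, conjTranspose_mul, hQ,
    S.P_sa, Matrix.mul_assoc, trace_mul_comm]
  simp only [Matrix.mul_assoc, hQQ]
  rw [← Matrix.mul_assoc (S.P x a) (S.P x a), S.P_proj]
  exact h

lemma Aop_zero_zero_of_odd {i : ℕ} (hi : i % 2 = 1) (k : ℕ) : Aop 0 0 i k = 0 := by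
  have : ∀ m, evm m (pl sz) i k = 0 := fun m => by
    have : i ≠ 2 * m := by omega
    simp [evm, embed, pl, sz, Matrix.one_apply, this]
  simp [Aop, sumB, this]

lemma Aop_zero_one_of_even {i : ℕ} (hi : i % 2 = 0) (k : ℕ) : Aop 0 1 i k = 0 := by
  have : ∀ m, evm m (mn sz) i k = 0 := fun m => by
    have : i ≠ 2 * m + 1 := by omega
    simp [evm, embed, mn, sz, Matrix.one_apply, this]
  simp [Aop, sumB, this]

lemma Aop_zero_two (i k : ℕ) : Aop 0 2 i k = 0 := rfl

lemma Bop_four (α : ℝ) (b : Fin 3) : Bop α 4 b = Aop 0 b := by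
  fin_cases b <;> rfl

lemma pstar_zero_four_eq_zero (α : ℝ) {a b : Fin 3} (h : a ≠ b ∨ a = 2) :
    pstar α 0 4 a b = 0 := by
  have hterm : ∀ i k, Aop 0 a i k * Aop 0 b i k = 0 := fun i k => by
    rcases Nat.mod_two_eq_zero_or_one i with hi | hi
    · have h1 := Aop_zero_one_of_even hi k
      fin_cases a <;> fin_cases b <;> simp_all [Aop_zero_two]
    · have h0 := Aop_zero_zero_of_odd hi k
      fin_cases a <;> fin_cases b <;> simp_all [Aop_zero_two]
  simp [pstar, Bop_four, mul_assoc, hterm]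

end Sep

open Sep in
/-- for any finite-dimensional strategy inducing `p*`, the multiset of
nonzero Schmidt coefficients of `ψ` splits as
`Schmidt(ψ) = Schmidt((P_0^0⊗I)ψ) + Schmidt((P_0^1⊗I)ψ)`. -/
theorem schmidt_splits_along_first_question
    (α : ℝ) (hα0 : 0 < α) (hα1 : α < 1)
    {dA dB : ℕ} (hdA : 1 ≤ dA) (hdB : 1 ≤ dB) (S : Strategy dA dB)
    (hind : ∀ x y a b, induced S x y a b = (pstar α x y a b : ℂ)) :
    schmidt S.ψ = schmidt (actA (S.P 0 0) S.ψ) + schmidt (actA (S.P 0 1) S.ψ) := by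
  have hzero : ∀ a b : Fin 3, a ≠ b ∨ a = 2 → S.P 0 a * cmat S.ψ * (S.Q 4 b)ᵀ = 0 := fun a b h =>
    mul_cmat_mul_eq_zero_of_induced_eq_zero S (by
      rw [hind, pstar_zero_four_eq_zero α h, Complex.ofReal_zero])
  have hexpand : ∀ a, S.P 0 a * cmat S.ψ = ∑ b, S.P 0 a * cmat S.ψ * (S.Q 4 b)ᵀ := fun a => by
    rw [← Matrix.mul_sum, ← transpose_sum, S.Q_complete, transpose_one, Matrix.mul_one]
  have hP0 : S.P 0 0 * cmat S.ψ = S.P 0 0 * cmat S.ψ * (S.Q 4 0)ᵀ := by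
    conv_lhs => rw [hexpand]
    simp [Fin.sum_univ_three, hzero]
  have hP1 : S.P 0 1 * cmat S.ψ = S.P 0 1 * cmat S.ψ * (S.Q 4 1)ᵀ := by
    conv_lhs => rw [hexpand]
    simp [Fin.sum_univ_three, hzero]
  have hP2 : S.P 0 2 * cmat S.ψ = 0 := by
    rw [hexpand]
    simp [hzero]
  have hsum : cmat S.ψ = S.P 0 0 * cmat S.ψ + S.P 0 1 * cmat S.ψ := by
    conv_lhs => rw [← Matrix.one_mul (cmat S.ψ), ← S.P_complete 0]
    rw [Fin.sum_univ_three, Matrix.add_mul, Matrix.add_mul, hP2, add_zero]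
  have hPP : S.P 0 0 * S.P 0 1 = 0 :=
    proj_mul_proj_eq_zero (S.P_sa 0) (S.P_proj 0) (S.P_complete 0) (by decide)
  have hQQ : S.Q 4 1 * S.Q 4 0 = 0 :=
    proj_mul_proj_eq_zero (S.Q_sa 4) (S.Q_proj 4) (S.Q_complete 4) (by decide)
  have hrow : (S.P 0 0 * cmat S.ψ) * (S.P 0 1 * cmat S.ψ)ᴴ = 0 := by
    rw [hP0, hP1, conjTranspose_mul, (IsHermitian.transpose (S.Q_sa 4 1)).eq,
      Matrix.mul_assoc,
      ← Matrix.mul_assoc (S.Q 4 0)ᵀ, ← transpose_mul, hQQ]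
    simp
  have hrow' : (S.P 0 1 * cmat S.ψ) * (S.P 0 0 * cmat S.ψ)ᴴ = 0 := by
    simpa only [conjTranspose_mul, conjTranspose_conjTranspose, conjTranspose_zero] using
      congrArg conjTranspose hrow
  have hcol : (S.P 0 0 * cmat S.ψ)ᴴ * (S.P 0 1 * cmat S.ψ) = 0 := by
    rw [conjTranspose_mul, S.P_sa, Matrix.mul_assoc, ← Matrix.mul_assoc (S.P 0 0), hPP,
      Matrix.zero_mul, Matrix.mul_zero]
  rw [schmidt, schmidt, schmidt, ← Multiset.map_add]
  refine congrArg _ (filter_eigenvalues_of_mul_eq_zero _ _ _ ?_ ?_)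
  · rw [cmat_actA, cmat_actA]
    conv_lhs => rw [hsum]
    rw [conjTranspose_add, Matrix.add_mul, Matrix.mul_add, Matrix.mul_add, hrow, hrow', add_zero,
      zero_add]
  · rw [cmat_actA, cmat_actA, Matrix.mul_assoc, ← Matrix.mul_assoc (S.P 0 0 * cmat S.ψ)ᴴ, hcol,
      Matrix.zero_mul, Matrix.mul_zero]
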